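/- Let n ≥ 1, let Ω₁ be a real symmetric 2n×2n matrix, and let γ₁, …, γ_n and γ'₁, …, γ'_n : [0,∞) → (0,∞) be continuous with finite integrals ∫₀^∞ γ_i(t) dt, ∫₀^∞ t·γ_i(t) dt, ∫₀^∞ γ'_i(t) dt, ∫₀^∞ t·γ'_i(t) dt for each i. Set γ̄_i = ∫₀^∞ γ_i(t) dt, Γ_{n+} = ∫₀^∞ max_i γ_i(t) dt, p(t) = (max_i γ_i(t))/Γ_{n+}, σ_min = min_i γ̄_i, σ_max = max_i γ̄_i, and analogously γ̄'_i, Γ'_{n+}, p'(t) for the primed kernels. Assume: (i) there exists a > ‖J_n·Ω₁‖ with ∫₀^∞ t·p(t) dt < |Re(λ₁) − a|^{2n}·σ_min / ( n·(2‖J_n·Ω₁‖ + 2a·Γ_{n+}/σ_min)^{2n} · (2a·Γ_{n+}/σ_min) · σ_max ), where λ₁ is the eigenvalue of J_n·Ω₁ with largest real part; (ii) γ̄'_i = γ̄_i for every i; and (iii) ∫₀^∞ t·p'(t) dt ≤ ∫₀^∞ t·p(t) dt. Then every continuously differentiable e : [0,∞) → ℝ^{2n} satisfying e'(t) = 2·J_n·Ω₁·e(t)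 − 2a·∫₀^t diag((γ'₁(t−τ)/γ̄'₁)·I₂, …, (γ'_n(t−τ)/γ̄'_n)·I₂)·e(τ) dτ for all t ≥ 0 converges to 0 as t → ∞. -/

import Mathlib

open Matrix MeasureTheory Set Filter

/-- `J_k = I_k ⊗ J` where `J = [[0,1],[-1,0]]`: the `2k × 2k` block-diagonal matrix
with `2×2` blocks `J` (interleaved coordinate ordering). -/
def Jmat (k : ℕ) : Matrix (Fin (2*k)) (Fin (2*k)) ℝ :=
  Matrix.of fun i j =>
    if (i : ℕ) % 2 = 0 ∧ (j : ℕ) = (i : ℕ) + 1 then 1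
    else if (i : ℕ) % 2 = 1 ∧ (j : ℕ) + 1 = (i : ℕ) then -1 else 0

/-- Operator norm of a real matrix induced by the Euclidean norm. -/
noncomputable def opNormR {N : ℕ} (M : Matrix (Fin N) (Fin N) ℝ) : ℝ :=
  ‖LinearMap.toContinuousLinearMap (Matrix.toEuclideanLin M)‖

/-- The function `f` is asymptotically bounded above by `s` at `+∞`. -/
def EvBound (f : ℝ → ℝ) (s : ℝ) : Prop :=
  ∀ δ > 0, ∀ᶠ t in atTop, f t ≤ s + δ

/-- Gain of a chain of `k` first-order equations with decay rate `d` and couplings at most `b`. -/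
noncomputable def chainGain (b d : ℝ) : ℕ → ℝ
  | 0 => 0
  | k + 1 => (1 + b * chainGain b d k) / d

theorem chainGain_nonneg {b d : ℝ} (hb : 0 ≤ b) (hd : 0 < d) (k : ℕ) : 0 ≤ chainGain b d k := by
  induction k with
  | zero => simp [chainGain]
  | succ k ih => simp only [chainGain]; positivity

theorem mul_chainGain_le {b d R : ℝ} (hb : 0 ≤ b) (hd : 0 < d) (hbR : b ≤ R) (hdR : d ≤ R)
    (k : ℕ) : R * chainGain b d k ≤ k * (R / d) ^ k := by
  have hR : 0 < R := hd.trans_le hdR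
  have h1 : 1 ≤ R / d := (one_le_div hd).2 hdR
  induction k with
  | zero => simp [chainGain]
  | succ k ih =>
    have hg := chainGain_nonneg hb hd k
    have h2 : b * chainGain b d k ≤ k * (R / d) ^ k :=
      (mul_le_mul_of_nonneg_right hbR hg).trans ih
    have h3 : 1 ≤ (R / d) ^ k := one_le_pow₀ h1
    calc R * chainGain b d (k + 1) = (R / d) * (1 + b * chainGain b d k) := by
          simp only [chainGain]; ring
      _ ≤ (R / d) * ((R / d) ^ k + k * (R / d) ^ k) := by gcongr
      _ = ((k + 1 : ℕ) : ℝ) * (R / d) ^ (k + 1) := by push_cast; ring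

section FirstOrder

variable {E : Type*} [NormedAddCommGroup E] [NormedSpace ℂ E]

theorem norm_le_of_hasDerivWithinAt_smul_add {μ : ℂ} {d F T X : ℝ} (hd : 0 < d) (hμ : μ.re ≤ -d)
    (hT : 0 ≤ T) {z f : ℝ → E}
    (hz : ∀ t ≥ 0, HasDerivWithinAt z (μ • z t + f t) (Ici 0) t)
    (hf : ∀ t ∈ Icc T X, ‖f t‖ ≤ F) {t : ℝ} (ht : t ∈ Icc T X) :
    ‖z t‖ ≤ Real.exp (-d * (t - T)) * ‖z T‖ + F / d := by
  have hF : 0 ≤ F := (norm_nonneg _).trans (hf t ht)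
  set c : ℝ := -μ.re with hc
  have hcd : d ≤ c := by linarith
  have hc0 : 0 < c := hd.trans_le hcd
  have hexpn : ∀ x : ℝ, ‖Complex.exp (-μ * x)‖ = Real.exp (c * x) := by
    intro x; rw [Complex.norm_exp]; simp [hc]
  have hexp : ∀ x : ℝ, HasDerivAt (fun x : ℝ => Complex.exp (-μ * x))
      (Complex.exp (-μ * x) * -μ) x := by
    intro x
    have h1 : HasDerivAt (fun x : ℝ => -μ * (x : ℂ)) (-μ) x := by
      simpa using (Complex.ofRealCLM.hasDerivAt (x := x)).const_mul (-μ)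
    exact h1.cexp
  have hw : ∀ x : ℝ, 0 ≤ x → HasDerivWithinAt (fun x : ℝ => Complex.exp (-μ * x) • z x)
      (Complex.exp (-μ * x) • f x) (Ici 0) x := by
    intro x hx
    have h := (hexp x).hasDerivWithinAt.smul (hz x hx)
    refine h.congr_deriv ?_
    module
  have key := image_norm_le_of_norm_deriv_right_le_deriv_boundary (E := E)
    (f := fun x : ℝ => Complex.exp (-μ * x) • z x) (f' := fun x => Complex.exp (-μ * x) • f x)
    (a := T) (b := X)
    (B := fun x => Real.exp (c * T) * ‖z T‖ + F / c * (Real.exp (c * x) - Real.exp (c * T)))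
    (B' := fun x => F * Real.exp (c * x))
    (fun x hx => ((hw x (hT.trans hx.1)).continuousWithinAt).mono
      fun y hy => hT.trans hy.1)
    (fun x hx => (hw x (hT.trans hx.1)).mono fun y hy => (hT.trans hx.1).trans hy)
    (by rw [norm_smul, hexpn]; simp)
    (fun x => by
      have h1 : HasDerivAt (fun x : ℝ => Real.exp (c * x)) (Real.exp (c * x) * c) x := by
        simpa using ((hasDerivAt_id x).const_mul c).exp
      have h2 := (((h1.sub_const (Real.exp (c * T))).const_mul (F / c)).const_add
        (Real.exp (c * T) * ‖z T‖))
      refine h2.congr_deriv ?_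
      field_simp)
    (fun x hx => by
      rw [norm_smul, hexpn, mul_comm]
      exact mul_le_mul_of_nonneg_right (hf x ⟨hx.1, hx.2.le⟩) (Real.exp_pos _).le)
    ht
  rw [norm_smul, hexpn] at key
  have hsplit : ‖z t‖ = Real.exp (-c * t) * (Real.exp (c * t) * ‖z t‖) := by
    rw [← mul_assoc, ← Real.exp_add]; simp
  have hFcd : F / c ≤ F / d := by gcongr
  calc ‖z t‖ = Real.exp (-c * t) * (Real.exp (c * t) * ‖z t‖) := hsplit
    _ ≤ Real.exp (-c * t) * (Real.exp (c * T) * ‖z T‖ + F / c * (Real.exp (c * t) - 0)) := by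
        gcongr
        refine key.trans ?_
        gcongr
        exact (Real.exp_pos _).le
    _ = Real.exp (-c * (t - T)) * ‖z T‖ + F / c := by
        have e1 : Real.exp (-c * t) * Real.exp (c * T) = Real.exp (-c * (t - T)) := by
          rw [← Real.exp_add]; ring_nf
        have e2 : Real.exp (-c * t) * Real.exp (c * t) = 1 := by
          rw [← Real.exp_add]; simp
        rw [← e1]
        linear_combination (F / c) * e2
    _ ≤ Real.exp (-d * (t - T)) * ‖z T‖ + F / d := by
        have := ht.1
        gcongr

theorem EvBound.of_hasDerivWithinAt_smul_add {μ : ℂ} {d F : ℝ} (hd : 0 < d) (hμ : μ.re ≤ -d)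
    {z f : ℝ → E} (hz : ∀ t ≥ 0, HasDerivWithinAt z (μ • z t + f t) (Ici 0) t)
    (hf : EvBound (fun t => ‖f t‖) F) : EvBound (fun t => ‖z t‖) (F / d) := by
  intro δ hδ
  obtain ⟨T, hT⟩ := eventually_atTop.1
    ((hf (δ * d / 2) (by positivity)).and (eventually_ge_atTop 0))
  have hT0 : 0 ≤ T := (hT T le_rfl).2
  have hlim : Tendsto (fun t => Real.exp (-d * (t - T)) * ‖z T‖) atTop (nhds 0) := by
    have h1 : Tendsto (fun t : ℝ => -d * (t - T)) atTop atBot :=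
      (tendsto_atTop_add_const_right _ (-T) tendsto_id).const_mul_atTop_of_neg (by linarith)
    simpa using (Real.tendsto_exp_atBot.comp h1).mul_const ‖z T‖
  filter_upwards [hlim.eventually_lt_const (half_pos hδ), eventually_ge_atTop T] with t ht htT
  have := norm_le_of_hasDerivWithinAt_smul_add (X := t) hd hμ hT0 hz
    (fun s hs => (hT s hs.1).1) ⟨htT, le_rfl⟩
  have h2 : (F + δ * d / 2) / d = F / d + δ / 2 := by field_simp
  linarith

variable {B : E →L[ℂ] E} {b d : ℝ}

theorem hasDerivWithinAt_sub_smul_apply {z f : ℝ → E} {s : Set ℝ} {t : ℝ} (μ : ℂ)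
    (hz : HasDerivWithinAt z (B (z t) + f t) s t) :
    HasDerivWithinAt (fun t => (B - μ • 1) (z t))
      (B ((B - μ • 1) (z t)) + (B - μ • 1) (f t)) s t := by
  have h := ((B - μ • (1 : E →L[ℂ] E)).restrictScalars ℝ).hasFDerivAt.comp_hasDerivWithinAt t hz
  refine h.congr_deriv ?_
  simp only [ContinuousLinearMap.coe_restrictScalars', map_add, _root_.sub_apply,
    _root_.smul_apply, one_apply_eq_self, map_sub, map_smul]

theorem hasDerivWithinAt_eigen_form {z f : ℝ → E} {s : Set ℝ} {t : ℝ} (μ : ℂ)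
    (hz : HasDerivWithinAt z (B (z t) + f t) s t) :
    HasDerivWithinAt z (μ • z t + ((B - μ • 1) (z t) + f t)) s t := by
  refine hz.congr_deriv ?_
  simp only [_root_.sub_apply, _root_.smul_apply, one_apply_eq_self]
  abel

theorem aeval_prod_cons_apply (μ : ℂ) (L : List ℂ) (x : E) :
    Polynomial.aeval B ((μ :: L).map fun r => Polynomial.X - Polynomial.C r).prod x =
      Polynomial.aeval B (L.map fun r => Polynomial.X - Polynomial.C r).prod
        ((B - μ • 1) x) := by
  rw [List.map_cons, List.prod_cons, mul_comm, map_mul]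
  simp [Algebra.algebraMap_eq_smul_one]

theorem EvBound.of_chain (hb : 0 ≤ b) (hd : 0 < d) (L : List ℂ) (hL : ∀ μ ∈ L, μ.re ≤ -d)
    (hB : ∀ μ ∈ L, ‖B - μ • 1‖ ≤ b) :
    ∀ (z f : ℝ → E) (F : ℝ), (∀ t ≥ 0, HasDerivWithinAt z (B (z t) + f t) (Ici 0) t) →
      (∀ t, Polynomial.aeval B (L.map fun r => Polynomial.X - Polynomial.C r).prod (z t) = 0) →
      EvBound (fun t => ‖f t‖) F →
      EvBound (fun t => ‖z t‖) (chainGain b d L.length * F) := by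
  induction L with
  | nil =>
    intro z f F _ h0 _ δ hδ
    refine Eventually.of_forall fun t => ?_
    have : z t = 0 := by simpa using h0 t
    simp [this, chainGain, hδ.le]
  | cons μ L ih =>
    intro z f F hz h0 hf
    simp only [List.forall_mem_cons] at hL hB
    have hstep := ih hL.2 hB.2 (fun t => (B - μ • 1) (z t)) (fun t => (B - μ • 1) (f t)) (b * F)
      (fun t ht => hasDerivWithinAt_sub_smul_apply μ (hz t ht))
      (fun t => by rw [← aeval_prod_cons_apply]; exact h0 t)
      (by
        intro δ hδ
        filter_upwards [hf (δ / (b + 1)) (by positivity)] with t ht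
        have h1 : b * (δ / (b + 1)) ≤ δ := by
          rw [mul_div_assoc', div_le_iff₀ (by positivity)]; nlinarith
        calc ‖(B - μ • 1) (f t)‖ ≤ b * ‖f t‖ := (B - μ • 1).le_of_opNorm_le hB.1 _
          _ ≤ b * (F + δ / (b + 1)) := by gcongr
          _ ≤ b * F + δ := by linarith)
    have hsum : EvBound (fun t => ‖(B - μ • 1) (z t) + f t‖)
        (chainGain b d L.length * (b * F) + F) := by
      intro δ hδ
      filter_upwards [hstep (δ / 2) (half_pos hδ), hf (δ / 2) (half_pos hδ)] with t h1 h2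
      linarith [norm_add_le ((B - μ • 1) (z t)) (f t)]
    have := EvBound.of_hasDerivWithinAt_smul_add hd hL.1
      (fun t ht => hasDerivWithinAt_eigen_form μ (hz t ht)) hsum
    convert this using 1
    simp only [List.length_cons, chainGain]
    ring

theorem exists_norm_le_of_chain (hb : 0 ≤ b) (hd : 0 < d) (L : List ℂ)
    (hL : ∀ μ ∈ L, μ.re ≤ -d) (hB : ∀ μ ∈ L, ‖B - μ • 1‖ ≤ b) :
    ∀ (z f : ℝ → E), (∀ t ≥ 0, HasDerivWithinAt z (B (z t) + f t) (Ici 0) t) →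
      (∀ t, Polynomial.aeval B (L.map fun r => Polynomial.X - Polynomial.C r).prod (z t) = 0) →
      ∃ C, ∀ F X, (∀ t ∈ Icc 0 X, ‖f t‖ ≤ F) →
        ∀ t ∈ Icc 0 X, ‖z t‖ ≤ C + chainGain b d L.length * F := by
  induction L with
  | nil =>
    intro z f _ h0
    refine ⟨0, fun F X _ t _ => ?_⟩
    have : z t = 0 := by simpa using h0 t
    simp [this, chainGain]
  | cons μ L ih =>
    intro z f hz h0
    simp only [List.forall_mem_cons] at hL hB
    obtain ⟨C, hC⟩ := ih hL.2 hB.2 (fun t => (B - μ • 1) (z t)) (fun t => (B - μ • 1) (f t))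
      (fun t ht => hasDerivWithinAt_sub_smul_apply μ (hz t ht))
      (fun t => by rw [← aeval_prod_cons_apply]; exact h0 t)
    refine ⟨‖z 0‖ + C / d, fun F X hF t ht => ?_⟩
    have hstep := hC (b * F) X fun s hs =>
      ((B - μ • 1).le_of_opNorm_le hB.1 _).trans (by gcongr; exact hF s hs)
    have := norm_le_of_hasDerivWithinAt_smul_add (F := C + chainGain b d L.length * (b * F) + F)
      hd hL.1 le_rfl (fun t ht => hasDerivWithinAt_eigen_form μ (hz t ht))
      (fun s hs => (norm_add_le _ _).trans (add_le_add (hstep s hs) (hF s hs))) ht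
    refine this.trans ?_
    have hexp : Real.exp (-d * (t - 0)) ≤ 1 := by
      rw [Real.exp_le_one_iff]; nlinarith [ht.1]
    have h2 := mul_le_mul_of_nonneg_right hexp (norm_nonneg (z 0))
    have h3 : (C + chainGain b d L.length * (b * F) + F) / d =
        C / d + chainGain b d (μ :: L).length * F := by
      simp only [List.length_cons, chainGain]; ring
    linarith

end FirstOrder

theorem integral_Icc_conv_swap (κ u : ℝ → ℝ) {t : ℝ} (ht : 0 ≤ t) :
    ∫ τ in Icc 0 t, κ (t - τ) * u τ = ∫ τ in Ioc 0 t, κ τ * u (t - τ) := by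
  rw [integral_Icc_eq_integral_Ioc, ← intervalIntegral.integral_of_le ht,
    ← intervalIntegral.integral_of_le ht]
  have := intervalIntegral.integral_comp_sub_left (a := 0) (b := t) (fun x => κ x * u (t - x)) t
  simpa using this

section Kernel

variable {κ u : ℝ → ℝ} {T t : ℝ}

theorem integrableOn_add_indicator (hint : IntegrableOn κ (Ioi 0)) (s S : ℝ) :
    IntegrableOn (fun τ => κ τ * s + (Ioi (t - T)).indicator κ τ * S) (Ioi 0) :=
  (hint.mul_const s).add ((hint.indicator measurableSet_Ioi).mul_const S)

theorem integral_indicator_Ioi (hTt : T ≤ t) :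
    ∫ τ in Ioi 0, (Ioi (t - T)).indicator κ τ = ∫ τ in Ioi (t - T), κ τ := by
  rw [setIntegral_indicator measurableSet_Ioi, Ioi_inter_Ioi, sup_eq_right.2 (by linarith)]

theorem abs_conv_le (hpos : ∀ τ ≥ 0, 0 ≤ κ τ) (hint : IntegrableOn κ (Ioi 0)) (hT : 0 ≤ T)
    (hTt : T ≤ t) {s S : ℝ} (hs : 0 ≤ s) (hS : 0 ≤ S) (hu : ∀ τ ∈ Icc T t, |u τ| ≤ s)
    (hu' : ∀ τ ∈ Ico 0 T, |u τ| ≤ S) :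
    |∫ τ in Icc 0 t, κ (t - τ) * u τ| ≤
      (∫ τ in Ioi 0, κ τ) * s + (∫ τ in Ioi (t - T), κ τ) * S := by
  rw [integral_Icc_conv_swap κ u (hT.trans hTt)]
  have hb := integrableOn_add_indicator (T := T) (t := t) hint s S
  have hnn : ∀ τ ∈ Ioi (0 : ℝ), 0 ≤ (Ioi (t - T)).indicator κ τ := fun τ hτ =>
    indicator_apply_nonneg fun _ => hpos τ (le_of_lt hτ)
  have hsub : Ioc 0 t ⊆ Ioi (0 : ℝ) := fun τ hτ => hτ.1
  calc |∫ τ in Ioc 0 t, κ τ * u (t - τ)|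
      ≤ ∫ τ in Ioc 0 t, (κ τ * s + (Ioi (t - T)).indicator κ τ * S) := by
        rw [← Real.norm_eq_abs]
        refine norm_integral_le_of_norm_le (hb.mono_set hsub) ?_
        filter_upwards [ae_restrict_mem measurableSet_Ioc] with τ hτ
        have hk := hpos τ hτ.1.le
        rw [Real.norm_eq_abs, abs_mul, abs_of_nonneg hk]
        by_cases h : τ ≤ t - T
        · have := hu (t - τ) ⟨by linarith, by linarith [hτ.1]⟩
          have := mul_nonneg (hnn τ hτ.1) hS
          nlinarith
        · have := hu' (t - τ) ⟨by linarith [hτ.2], by linarith⟩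
          rw [indicator_of_mem (by simpa using h)]
          nlinarith
    _ ≤ ∫ τ in Ioi 0, (κ τ * s + (Ioi (t - T)).indicator κ τ * S) := by
        refine setIntegral_mono_set hb ?_ hsub.eventuallyLE
        filter_upwards [ae_restrict_mem measurableSet_Ioi] with τ hτ
        have := hpos τ (le_of_lt hτ)
        have := hnn τ hτ
        positivity
    _ = _ := by
        rw [integral_add (hint.mul_const s) ((hint.indicator measurableSet_Ioi).mul_const S),
          integral_mul_const, integral_mul_const, integral_indicator_Ioi hTt]

theorem abs_sub_conv_le (hpos : ∀ τ ≥ 0, 0 ≤ κ τ) (hcont : ContinuousOn κ (Ici 0))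
    (hint : IntegrableOn κ (Ioi 0)) (htint : IntegrableOn (fun τ => τ * κ τ) (Ioi 0))
    (hucont : ContinuousOn u (Ici 0)) (hT : 0 ≤ T) (hTt : T ≤ t) {Λ S : ℝ} (hΛ : 0 ≤ Λ)
    (hS : 0 ≤ S)
    (hu : ∀ τ ∈ Icc 0 t, |u t - u τ| ≤ Λ * (t - τ) + if τ < T then S else 0) :
    |(∫ τ in Ioi 0, κ τ) * u t - ∫ τ in Icc 0 t, κ (t - τ) * u τ| ≤
      (∫ τ in Ioi 0, τ * κ τ) * Λ + (∫ τ in Ioi (t - T), κ τ) * S +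
        (∫ τ in Ioi t, κ τ) * |u 0| := by
  have ht := hT.trans hTt
  rw [integral_Icc_conv_swap κ u ht]
  have hsub : Ioc 0 t ⊆ Ioi (0 : ℝ) := fun τ hτ => hτ.1
  have hsub' : Ioi t ⊆ Ioi (0 : ℝ) := Ioi_subset_Ioi ht
  have hi1 : IntegrableOn (fun τ => κ τ * u (t - τ)) (Ioc 0 t) := by
    refine IntegrableOn.mono_set (t := Icc 0 t) ?_ Ioc_subset_Icc_self
    refine ContinuousOn.integrableOn_Icc ((hcont.mono fun x hx => hx.1).mul ?_)
    exact hucont.comp (by fun_prop) fun x hx => by simpa using hx.2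
  have hsplit : ∫ τ in Ioi 0, κ τ = (∫ τ in Ioc 0 t, κ τ) + ∫ τ in Ioi t, κ τ := by
    rw [← Ioc_union_Ioi_eq_Ioi ht]
    exact setIntegral_union (Ioc_disjoint_Ioi le_rfl) measurableSet_Ioi
      (hint.mono_set hsub) (hint.mono_set hsub')
  have hrepr : (∫ τ in Ioi 0, κ τ) * u t - ∫ τ in Ioc 0 t, κ τ * u (t - τ) =
      (∫ τ in Ioc 0 t, κ τ * (u t - u (t - τ))) + (∫ τ in Ioi t, κ τ * (u t - u 0)) +
        (∫ τ in Ioi t, κ τ) * u 0 := by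
    simp only [mul_sub]
    rw [integral_sub ((hint.mono_set hsub).mul_const _) hi1,
      integral_sub ((hint.mono_set hsub').mul_const _) ((hint.mono_set hsub').mul_const _)]
    simp only [integral_mul_const]
    rw [hsplit]
    ring
  set g : ℝ → ℝ := fun τ => τ * κ τ * Λ + (Ioi (t - T)).indicator κ τ * S with hg
  have hgint : IntegrableOn g (Ioi 0) :=
    (htint.mul_const Λ).add ((hint.indicator measurableSet_Ioi).mul_const S)
  have hbd : ∀ τ > 0, ∀ σ ∈ Icc 0 t, t - σ ≤ τ → (σ < T → t - T < τ) →
      ‖κ τ * (u t - u σ)‖ ≤ g τ := by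
    intro τ hτ σ hσ h1 h2
    have hk := hpos τ hτ.le
    rw [Real.norm_eq_abs, abs_mul, abs_of_nonneg hk]
    have h3 := mul_le_mul_of_nonneg_left (hu σ hσ) hk
    have h4 : κ τ * (Λ * (t - σ)) ≤ κ τ * (Λ * τ) := by gcongr
    have h5 : κ τ * (if σ < T then S else 0) ≤ (Ioi (t - T)).indicator κ τ * S := by
      split_ifs with h
      · rw [indicator_of_mem (by exact h2 h)]
      · rw [mul_zero]
        exact mul_nonneg (indicator_apply_nonneg fun _ => hk) hS
    simp only [hg]
    linarith
  have hA : |∫ τ in Ioc 0 t, κ τ * (u t - u (t - τ))| ≤ ∫ τ in Ioc 0 t, g τ := by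
    rw [← Real.norm_eq_abs]
    refine norm_integral_le_of_norm_le (hgint.mono_set hsub) ?_
    filter_upwards [ae_restrict_mem measurableSet_Ioc] with τ hτ
    exact hbd τ hτ.1 _ ⟨by linarith [hτ.2], by linarith [hτ.1]⟩ (by linarith)
      fun h => by linarith
  have hB : |∫ τ in Ioi t, κ τ * (u t - u 0)| ≤ ∫ τ in Ioi t, g τ := by
    rw [← Real.norm_eq_abs]
    refine norm_integral_le_of_norm_le (hgint.mono_set hsub') ?_
    filter_upwards [ae_restrict_mem measurableSet_Ioi] with τ hτ
    have hτ' : t < τ := hτ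
    exact hbd τ (ht.trans_lt hτ') 0 ⟨le_rfl, ht⟩ (by linarith) fun h => by linarith
  have hAB : (∫ τ in Ioc 0 t, g τ) + ∫ τ in Ioi t, g τ =
      (∫ τ in Ioi 0, τ * κ τ) * Λ + (∫ τ in Ioi (t - T), κ τ) * S := by
    rw [← setIntegral_union (Ioc_disjoint_Ioi le_rfl) measurableSet_Ioi
      (hgint.mono_set hsub) (hgint.mono_set hsub'), Ioc_union_Ioi_eq_Ioi ht,
      integral_add (htint.mul_const Λ) ((hint.indicator measurableSet_Ioi).mul_const S),
      integral_mul_const, integral_mul_const, integral_indicator_Ioi hTt]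
  have hC : |(∫ τ in Ioi t, κ τ) * u 0| = (∫ τ in Ioi t, κ τ) * |u 0| := by
    rw [abs_mul, abs_of_nonneg]
    exact setIntegral_nonneg measurableSet_Ioi fun τ hτ => hpos τ (ht.trans (le_of_lt hτ))
  rw [hrepr]
  refine (abs_add_three _ _ _).trans ?_
  linarith

end Kernel

theorem abs_sub_le_of_abs_deriv_le {u u' : ℝ → ℝ} {T X Λ : ℝ} (hT : 0 ≤ T)
    (hu : ∀ t ≥ 0, HasDerivWithinAt u (u' t) (Ici 0) t) (hΛ : ∀ t ∈ Icc T X, |u' t| ≤ Λ)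
    {t τ : ℝ} (ht : t ≤ X) (hτ : T ≤ τ) (hτt : τ ≤ t) : |u t - u τ| ≤ Λ * (t - τ) := by
  have := (convex_Icc T X).norm_image_sub_le_of_norm_hasDerivWithin_le (f := u) (f' := u')
    (fun x hx => (hu x (hT.trans hx.1)).mono fun y hy => hT.trans hy.1) hΛ
    (x := τ) (y := t) ⟨hτ, hτt.trans ht⟩ ⟨hτ.trans hτt, ht⟩
  simpa [abs_of_nonneg (sub_nonneg.2 hτt)] using this

theorem EvBound.mono {f g : ℝ → ℝ} {s : ℝ} (hg : EvBound g s) (h : ∀ᶠ t in atTop, f t ≤ g t) :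
    EvBound f s := fun δ hδ => by
  filter_upwards [hg δ hδ, h] with t h1 h2 using h2.trans h1

theorem EvBound.add {f g : ℝ → ℝ} {s r : ℝ} (hf : EvBound f s) (hg : EvBound g r) :
    EvBound (fun t => f t + g t) (s + r) := fun δ hδ => by
  filter_upwards [hf (δ / 2) (half_pos hδ), hg (δ / 2) (half_pos hδ)] with t h1 h2
  linarith

theorem EvBound.const_mul {f : ℝ → ℝ} {s c : ℝ} (hf : EvBound f s) (hc : 0 ≤ c) :
    EvBound (fun t => c * f t) (c * s) := fun δ hδ => by
  filter_upwards [hf (δ / (c + 1)) (by positivity)] with t ht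
  have h1 : c * (δ / (c + 1)) ≤ δ := by
    rw [mul_div_assoc', div_le_iff₀ (by positivity)]; nlinarith
  nlinarith [mul_le_mul_of_nonneg_left ht hc]

theorem EvBound.of_forall_pos {f : ℝ → ℝ} {s c : ℝ} (hc : 0 ≤ c)
    (h : ∀ η > 0, EvBound f (c * (s + η))) : EvBound f (c * s) := fun δ hδ => by
  filter_upwards [h (δ / (2 * (c + 1))) (by positivity) (δ / 2) (half_pos hδ)] with t ht
  have h1 : c * (δ / (2 * (c + 1))) ≤ δ / 2 := by
    rw [mul_div_assoc', div_le_div_iff₀ (by positivity) (by positivity)]; nlinarith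
  linarith

theorem tendsto_tail_mul (κ : ℝ → ℝ) (T S : ℝ) :
    Tendsto (fun t => (∫ τ in Ioi (t - T), κ τ) * S) atTop (nhds 0) := by
  simpa [sub_eq_add_neg] using (tendsto_integral_Ioi_zero (f := κ) (μ := volume)
    (tendsto_atTop_add_const_right atTop (-T) tendsto_id)).mul_const S

theorem EvBound.conv {κ u : ℝ → ℝ} {s S : ℝ} (hpos : ∀ τ ≥ 0, 0 ≤ κ τ)
    (hint : IntegrableOn κ (Ioi 0)) (hs : 0 ≤ s) (hS : ∀ t ≥ 0, |u t| ≤ S)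
    (hu : EvBound (fun t => |u t|) s) :
    EvBound (fun t => |∫ τ in Icc 0 t, κ (t - τ) * u τ|) ((∫ τ in Ioi 0, κ τ) * s) := by
  have hS0 : 0 ≤ S := (abs_nonneg _).trans (hS 0 le_rfl)
  refine .of_forall_pos (setIntegral_nonneg measurableSet_Ioi fun τ hτ => hpos τ (le_of_lt hτ))
    fun η hη => ?_
  obtain ⟨T, hT⟩ := eventually_atTop.1 ((hu η hη).and (eventually_ge_atTop 0))
  have hT0 : 0 ≤ T := (hT T le_rfl).2
  intro δ hδ
  filter_upwards [(tendsto_tail_mul κ T S).eventually_lt_const hδ, eventually_ge_atTop T]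
    with t ht htT
  have := abs_conv_le hpos hint hT0 htT (by positivity : 0 ≤ s + η) hS0
    (fun τ hτ => (hT τ hτ.1).1) (fun τ hτ => hS τ hτ.1)
  linarith

theorem EvBound.sub_conv {κ u u' : ℝ → ℝ} {Λ S : ℝ} (hpos : ∀ τ ≥ 0, 0 ≤ κ τ)
    (hcont : ContinuousOn κ (Ici 0)) (hint : IntegrableOn κ (Ioi 0))
    (htint : IntegrableOn (fun τ => τ * κ τ) (Ioi 0))
    (hderiv : ∀ t ≥ 0, HasDerivWithinAt u (u' t) (Ici 0) t) (hΛ : 0 ≤ Λ)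
    (hS : ∀ t ≥ 0, |u t| ≤ S) (hu' : EvBound (fun t => |u' t|) Λ) :
    EvBound (fun t => |(∫ τ in Ioi 0, κ τ) * u t - ∫ τ in Icc 0 t, κ (t - τ) * u τ|)
      ((∫ τ in Ioi 0, τ * κ τ) * Λ) := by
  have hS0 : 0 ≤ S := (abs_nonneg _).trans (hS 0 le_rfl)
  refine .of_forall_pos (setIntegral_nonneg measurableSet_Ioi fun τ hτ =>
    mul_nonneg (le_of_lt hτ) (hpos τ (le_of_lt hτ))) fun η hη => ?_
  obtain ⟨T, hT⟩ := eventually_atTop.1 ((hu' η hη).and (eventually_ge_atTop 0))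
  have hT0 : 0 ≤ T := (hT T le_rfl).2
  intro δ hδ
  filter_upwards [(tendsto_tail_mul κ T (2 * S)).eventually_lt_const (half_pos hδ),
    (tendsto_tail_mul κ 0 |u 0|).eventually_lt_const (half_pos hδ), eventually_ge_atTop T]
    with t ht ht0 htT
  rw [sub_zero] at ht0
  have := abs_sub_conv_le hpos hcont hint htint
    (fun t ht => (hderiv t ht).continuousWithinAt) hT0 htT
    (by positivity : 0 ≤ Λ + η) (by positivity : 0 ≤ 2 * S) (fun τ hτ => by
      split_ifs with h
      · have h1 := abs_sub (u t) (u τ)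
        have h2 := hS t (hT0.trans htT)
        have h3 := hS τ hτ.1
        have h4 : 0 ≤ (Λ + η) * (t - τ) := mul_nonneg (by positivity) (by linarith [hτ.2])
        linarith
      · rw [add_zero]
        exact abs_sub_le_of_abs_deriv_le (X := t) hT0 hderiv (fun x hx => (hT x hx.1).1) le_rfl
          (not_lt.1 h) hτ.2)
  linarith

theorem tendsto_zero_of_evBound_contract {g : ℝ → ℝ} {q S : ℝ} (hg : ∀ t, 0 ≤ g t) (hq : q < 1)
    (hq0 : 0 ≤ q) (hS : 0 ≤ S) (hgS : EvBound g S)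
    (h : ∀ s ≥ 0, EvBound g s → EvBound g (q * s)) : Tendsto g atTop (nhds 0) := by
  have hpow : ∀ k : ℕ, EvBound g (q ^ k * S) := by
    intro k
    induction k with
    | zero => simpa using hgS
    | succ k ih =>
      have := h _ (by positivity) ih
      rwa [← mul_assoc, ← pow_succ'] at this
  have hlim : Tendsto (fun k : ℕ => q ^ k * S) atTop (nhds 0) := by
    simpa using (tendsto_pow_atTop_nhds_zero_of_lt_one hq0 hq).mul_const S
  rw [Metric.tendsto_nhds]
  intro δ hδ
  obtain ⟨k, hk⟩ := (hlim.eventually_lt_const (half_pos hδ)).exists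
  filter_upwards [hpow k (δ / 2) (half_pos hδ)] with t ht
  rw [Real.dist_0_eq_abs, abs_of_nonneg (hg t)]
  linarith

section Delay

variable {N : ℕ}

/-- A real vector viewed in the complex Euclidean space. -/
noncomputable def complexVec (x : Fin N → ℝ) : EuclideanSpace ℂ (Fin N) :=
  WithLp.toLp 2 fun i => (x i : ℂ)

theorem abs_le_norm_complexVec (x : Fin N → ℝ) (i : Fin N) : |x i| ≤ ‖complexVec x‖ := by
  simpa [complexVec] using PiLp.norm_apply_le (complexVec x) i

theorem norm_complexVec_le {x : Fin N → ℝ} {H : ℝ} (hH : 0 ≤ H) (hx : ∀ i, |x i| ≤ H) :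
    ‖complexVec x‖ ≤ √N * H := by
  rw [EuclideanSpace.norm_eq]
  refine Real.sqrt_le_iff.2 ⟨by positivity, ?_⟩
  rw [mul_pow, Real.sq_sqrt (by positivity)]
  calc ∑ i, ‖complexVec x i‖ ^ 2 ≤ ∑ _i : Fin N, H ^ 2 := by
        refine Finset.sum_le_sum fun i _ => ?_
        have : ‖complexVec x i‖ = |x i| := by simp [complexVec]
        rw [this]
        exact pow_le_pow_left₀ (abs_nonneg _) (hx i) 2
    _ = N * H ^ 2 := by simp

theorem toEuclideanCLM_complexVec (M : Matrix (Fin N) (Fin N) ℝ) (x : Fin N → ℝ) :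
    toEuclideanCLM (𝕜 := ℂ) (M.map Complex.ofReal) (complexVec x) = complexVec (M *ᵥ x) := by
  ext i
  simp [complexVec, toEuclideanCLM_toLp, mulVec, dotProduct]

theorem hasDerivWithinAt_complexVec {e : ℝ → Fin N → ℝ} {e' : Fin N → ℝ} {s : Set ℝ} {t : ℝ}
    (h : ∀ i, HasDerivWithinAt (fun t => e t i) (e' i) s t) :
    HasDerivWithinAt (fun t => complexVec (e t)) (complexVec e') s t := by
  have h1 : HasDerivWithinAt (fun t => fun i => (e t i : ℂ)) (fun i => (e' i : ℂ)) s t :=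
    hasDerivWithinAt_pi.2 fun i => (h i).ofReal_comp
  exact ((PiLp.continuousLinearEquiv 2 ℝ
    (fun _ : Fin N => ℂ)).symm.toContinuousLinearMap.hasFDerivAt.comp_hasDerivWithinAt t h1)

theorem exists_list_spectrum (A : Matrix (Fin N) (Fin N) ℂ) :
    ∃ L : List ℂ, L.length = N ∧ (∀ μ ∈ L, μ ∈ spectrum ℂ A) ∧
      Polynomial.aeval (toEuclideanCLM (𝕜 := ℂ) A)
        (L.map fun r => Polynomial.X - Polynomial.C r).prod = 0 := by
  refine ⟨A.charpoly.roots.toList, ?_, ?_, ?_⟩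
  · rw [Multiset.length_toList, IsAlgClosed.card_roots_eq_natDegree, charpoly_natDegree_eq_dim,
      Fintype.card_fin]
  · intro μ hμ
    rw [Multiset.mem_toList] at hμ
    exact mem_spectrum_of_isRoot_charpoly (Polynomial.isRoot_of_mem_roots hμ)
  · have h1 : (A.charpoly.roots.toList.map fun r => Polynomial.X - Polynomial.C r).prod =
        A.charpoly := by
      rw [← Multiset.prod_coe, ← Multiset.map_coe, Multiset.coe_toList]
      exact (((IsAlgClosed.splits A.charpoly).eq_prod_roots_of_monic A.charpoly_monic)).symm
    rw [h1]
    have := Polynomial.aeval_algHom_apply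
      (toEuclideanCLM (𝕜 := ℂ) (n := Fin N)).toAlgEquiv.toAlgHom A A.charpoly
    rw [aeval_self_charpoly, map_zero] at this
    exact this

variable {M : Matrix (Fin N) (Fin N) ℝ} {m a d ε : ℝ} {κ : Fin N → ℝ → ℝ} {e : ℝ → Fin N → ℝ}

theorem tendsto_zero_of_chain {B : EuclideanSpace ℂ (Fin N) →L[ℂ] EuclideanSpace ℂ (Fin N)}
    {b : ℝ} {L : List ℂ} (hb : 0 ≤ b) (hd : 0 < d) (hL : ∀ μ ∈ L, μ.re ≤ -d)
    (hB : ∀ μ ∈ L, ‖B - μ • 1‖ ≤ b)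
    (hL0 : Polynomial.aeval B (L.map fun r => Polynomial.X - Polynomial.C r).prod = 0)
    (hm0 : 0 ≤ m) (ha0 : 0 ≤ a) (hε : 0 ≤ ε)
    (hM : ∀ x i, |((2 : ℝ) • M *ᵥ x) i| ≤ 2 * m * ‖complexVec x‖)
    (hBM : ∀ x, B (complexVec x) = complexVec ((2 : ℝ) • M *ᵥ x - (2 * a) • x))
    (hpos : ∀ i, ∀ τ ≥ 0, 0 ≤ κ i τ) (hcont : ∀ i, ContinuousOn (κ i) (Ici 0))
    (hint : ∀ i, IntegrableOn (κ i) (Ioi 0))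
    (htint : ∀ i, IntegrableOn (fun τ => τ * κ i τ) (Ioi 0))
    (hmass : ∀ i, ∫ τ in Ioi 0, κ i τ = 2 * a) (hmean : ∀ i, ∫ τ in Ioi 0, τ * κ i τ ≤ ε)
    (hq : √N * ε * ((2 * m + 2 * a) * chainGain b d L.length) < 1)
    (he : ∀ t ≥ 0, ∀ i, HasDerivWithinAt (fun t => e t i)
      (((2 : ℝ) • M *ᵥ e t) i - ∫ τ in Icc 0 t, κ i (t - τ) * e τ i) (Ici 0) t) :
    Tendsto (fun t => ‖complexVec (e t)‖) atTop (nhds 0) := by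
  set G := chainGain b d L.length with hG
  have hG0 : 0 ≤ G := chainGain_nonneg hb hd _
  set R := 2 * m + 2 * a with hR
  have hR0 : 0 ≤ R := by positivity
  set y : ℝ → ℝ := fun t => ‖complexVec (e t)‖ with hy
  have hy0 : ∀ t, 0 ≤ y t := fun t => norm_nonneg _
  have hey : ∀ t i, |e t i| ≤ y t := fun t i => abs_le_norm_complexVec (e t) i
  set h : ℝ → Fin N → ℝ :=
    fun t i => 2 * a * e t i - ∫ τ in Icc 0 t, κ i (t - τ) * e τ i with hh
  have hz : ∀ t ≥ 0, HasDerivWithinAt (fun t => complexVec (e t))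
      (B (complexVec (e t)) + complexVec (h t)) (Ici 0) t := by
    intro t ht
    refine (hasDerivWithinAt_complexVec (he t ht)).congr_deriv ?_
    rw [hBM]
    ext i
    simp [complexVec, hh]
  have hycont : ContinuousOn y (Ici 0) := fun t ht => (hz t ht).continuousWithinAt.norm
  have hecont : ∀ i, ContinuousOn (fun t => e t i) (Ici 0) := fun i t ht =>
    (he t ht i).continuousWithinAt
  obtain ⟨C, hC⟩ := exists_norm_le_of_chain hb hd L hL hB _ _ hz (fun t => by simp [hL0])
  have hbdd : ∀ X ≥ 0, y X ≤ (C + G * (√N * (2 * a * y 0))) / (1 - √N * ε * (R * G)) := by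
    intro X hX
    obtain ⟨x, hx, hmax⟩ := isCompact_Icc.exists_isMaxOn (nonempty_Icc.2 hX)
      (hycont.mono fun t (ht : t ∈ Icc 0 X) => ht.1)
    have hmax' : ∀ t ∈ Icc 0 X, y t ≤ y x := fun t ht => hmax ht
    have hf : ∀ t ∈ Icc 0 X, ‖complexVec (h t)‖ ≤ √N * (ε * (R * y x) + 2 * a * y 0) := by
      intro t ht
      have hderiv : ∀ i, ∀ s ∈ Icc 0 X,
          |((2 : ℝ) • M *ᵥ e s) i - ∫ τ in Icc 0 s, κ i (s - τ) * e τ i| ≤ R * y x := by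
        intro i s hs
        have h1 := abs_conv_le (u := fun t => e t i) (hpos i) (hint i) le_rfl hs.1 (hy0 x) le_rfl
          (fun τ hτ => (hey τ i).trans (hmax' τ ⟨hτ.1, hτ.2.trans hs.2⟩))
          (fun τ hτ => absurd hτ.2 (not_lt.2 hτ.1))
        rw [hmass, mul_zero, add_zero] at h1
        have h2 := hM (e s) i
        have h3 := mul_le_mul_of_nonneg_left (hmax' s hs) (by positivity : 0 ≤ 2 * m)
        refine (abs_sub _ _).trans ?_
        rw [hR, add_mul]
        linarith
      refine norm_complexVec_le (by have := hy0 x; have := hy0 0; positivity) fun i => ?_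
      have h1 := abs_sub_conv_le (u := fun t => e t i) (Λ := R * y x) (S := 0) (hpos i) (hcont i)
        (hint i) (htint i) (hecont i) le_rfl ht.1 (mul_nonneg hR0 (hy0 x)) le_rfl
        (fun τ hτ => by
          rw [ite_self, add_zero]
          exact abs_sub_le_of_abs_deriv_le le_rfl (fun s hs => he s hs i) (hderiv i) ht.2 hτ.1
            hτ.2)
      rw [hmass, mul_zero, add_zero] at h1
      have h2 : ∫ τ in Ioi t, κ i τ ≤ 2 * a := by
        rw [← hmass i]
        refine setIntegral_mono_set (hint i) ?_ (Ioi_subset_Ioi ht.1).eventuallyLE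
        filter_upwards [ae_restrict_mem measurableSet_Ioi] with τ hτ using hpos i τ (le_of_lt hτ)
      refine h1.trans (add_le_add ?_ ?_)
      · exact mul_le_mul_of_nonneg_right (hmean i) (mul_nonneg hR0 (hy0 x))
      · exact mul_le_mul h2 (hey 0 i) (abs_nonneg _) (by positivity)
    have hS := hC _ X hf x hx
    have hlt : 0 < 1 - √N * ε * (R * G) := by linarith
    refine (hmax' X ⟨hX, le_rfl⟩).trans ?_
    rw [le_div_iff₀ hlt]
    have hS' : y x ≤ C + G * (√N * (ε * (R * y x) + 2 * a * y 0)) := hS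
    linarith
  set S := (C + G * (√N * (2 * a * y 0))) / (1 - √N * ε * (R * G)) with hS
  have hS0 : 0 ≤ S := (hy0 0).trans (hbdd 0 le_rfl)
  refine tendsto_zero_of_evBound_contract hy0 hq (by positivity) hS0
    (fun δ hδ => ?_) fun s hs hys => ?_
  · filter_upwards [eventually_ge_atTop 0] with t ht
    linarith [hbdd t ht]
  · have hcoord : ∀ i, EvBound (fun t => |h t i|) (ε * (R * s)) := by
      intro i
      have hbd : ∀ t ≥ 0, |e t i| ≤ S := fun t ht => (hey t i).trans (hbdd t ht)
      have h1 := EvBound.conv (hpos i) (hint i) hs hbd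
        (hys.mono (Eventually.of_forall fun t => hey t i))
      rw [hmass] at h1
      have h2 : EvBound
          (fun t => |((2 : ℝ) • M *ᵥ e t) i - ∫ τ in Icc 0 t, κ i (t - τ) * e τ i|) (R * s) := by
        rw [hR, add_mul]
        exact ((hys.const_mul (by positivity : 0 ≤ 2 * m)).add h1).mono
          (Eventually.of_forall fun t => (abs_sub _ _).trans (by gcongr; exact hM _ i))
      have h3 := EvBound.sub_conv (hpos i) (hcont i) (hint i) (htint i)
        (fun t ht => he t ht i) (by positivity) hbd h2
      rw [hmass] at h3
      intro δ hδ
      filter_upwards [h3 δ hδ] with t ht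
      exact ht.trans (by gcongr; exact hmean i)
    have hvec : EvBound (fun t => ‖complexVec (h t)‖) (√N * (ε * (R * s))) := by
      refine .of_forall_pos (Real.sqrt_nonneg _) fun η hη δ hδ => ?_
      filter_upwards [eventually_all.2 fun i => hcoord i η hη] with t ht
      linarith [norm_complexVec_le (by positivity) ht]
    convert EvBound.of_chain hb hd L hL hB _ _ _ hz (fun t => by simp [hL0]) hvec using 1
    ring

theorem norm_toEuclideanCLM_map_ofReal_le (M : Matrix (Fin N) (Fin N) ℝ) :
    ‖toEuclideanCLM (𝕜 := ℂ) (M.map Complex.ofReal)‖ ≤ opNormR M := by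
  refine ContinuousLinearMap.opNorm_le_bound _ (norm_nonneg _) fun x => ?_
  have hreal : ∀ v : Fin N → ℝ, ∑ i, (M *ᵥ v) i ^ 2 ≤ opNormR M ^ 2 * ∑ i, v i ^ 2 := by
    intro v
    have h1 := (LinearMap.toContinuousLinearMap (toEuclideanLin M)).le_opNorm (WithLp.toLp 2 v)
    have h2 := pow_le_pow_left₀ (norm_nonneg _) h1 2
    rw [mul_pow, EuclideanSpace.real_norm_sq_eq, EuclideanSpace.real_norm_sq_eq] at h2
    simpa [opNormR] using h2
  refine le_of_sq_le_sq ?_ (mul_nonneg (norm_nonneg _) (norm_nonneg _))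
  rw [mul_pow, EuclideanSpace.norm_sq_eq, EuclideanSpace.norm_sq_eq]
  have hre : ∀ i, ((M.map Complex.ofReal) *ᵥ x.ofLp) i =
      ⟨(M *ᵥ fun j => (x j).re) i, (M *ᵥ fun j => (x j).im) i⟩ := by
    intro i
    apply Complex.ext <;> simp [mulVec, dotProduct]
  simp only [ofLp_toEuclideanCLM, hre, Complex.sq_norm, Complex.normSq_apply, ← sq,
    Finset.sum_add_distrib, mul_add]
  exact add_le_add (hreal _) (hreal _)

theorem sqrt_mul_self_lt_two_pow (N : ℕ) : √N * N < 2 ^ N := by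
  have hnat : N ^ 3 < 4 ^ N := by
    rcases Nat.lt_or_ge N 2 with h | h
    · interval_cases N <;> norm_num
    · induction N, h using Nat.le_induction with
      | base => norm_num
      | succ k hk ih =>
        rw [pow_succ 4]
        nlinarith [mul_le_mul hk hk (by norm_num) (by omega), mul_le_mul hk le_rfl
          (Nat.zero_le (k * k)) (by omega)]
  have hreal : (N : ℝ) ^ 3 < 4 ^ N := by exact_mod_cast hnat
  refine lt_of_pow_lt_pow_left₀ 2 (by positivity) ?_
  rw [mul_pow, Real.sq_sqrt (by positivity), ← pow_mul, mul_comm N 2, pow_mul]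
  norm_num
  linarith

theorem tendsto_zero_of_delay {lam : ℂ} (hm : opNormR M < a)
    (hlam : lam ∈ spectrum ℂ (M.map Complex.ofReal))
    (hlammax : ∀ μ ∈ spectrum ℂ (M.map Complex.ofReal), μ.re ≤ lam.re)
    (hpos : ∀ i, ∀ τ ≥ 0, 0 ≤ κ i τ) (hcont : ∀ i, ContinuousOn (κ i) (Ici 0))
    (hint : ∀ i, IntegrableOn (κ i) (Ioi 0))
    (htint : ∀ i, IntegrableOn (fun τ => τ * κ i τ) (Ioi 0))
    (hmass : ∀ i, ∫ τ in Ioi 0, κ i τ = 2 * a)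
    (hmean : ∀ i, ∫ τ in Ioi 0, τ * κ i τ ≤ (|lam.re - a| / (2 * opNormR M + 2 * a)) ^ N)
    (he : ∀ t ≥ 0, ∀ i, HasDerivWithinAt (fun t => e t i)
      (((2 : ℝ) • M *ᵥ e t) i - ∫ τ in Icc 0 t, κ i (t - τ) * e τ i) (Ici 0) t) :
    Tendsto e atTop (nhds 0) := by
  set m := opNormR M with hmdef
  have hm0 : 0 ≤ m := norm_nonneg _
  have ha0 : 0 < a := hm0.trans_lt hm
  set P := toEuclideanCLM (𝕜 := ℂ) (M.map Complex.ofReal) with hP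
  have hPm : ‖P‖ ≤ m := norm_toEuclideanCLM_map_ofReal_le M
  have hspec : ∀ μ ∈ spectrum ℂ (M.map Complex.ofReal), ‖μ‖ ≤ m := by
    intro μ hμ
    have hμ' : μ ∈ spectrum ℂ P := by
      rw [hP, AlgEquiv.spectrum_eq (toEuclideanCLM (𝕜 := ℂ) (n := Fin N))]
      exact hμ
    have h1 := spectrum.norm_le_norm_mul_of_mem hμ'
    have h2 : ‖(1 : EuclideanSpace ℂ (Fin N) →L[ℂ] EuclideanSpace ℂ (Fin N))‖ ≤ 1 :=
      ContinuousLinearMap.norm_id_le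
    nlinarith [norm_nonneg P]
  have hlamre : |lam.re| ≤ m := (Complex.abs_re_le_norm lam).trans (hspec lam hlam)
  have hlam' := abs_le.1 hlamre
  have habs : |lam.re - a| = a - lam.re := by
    rw [abs_of_neg (by linarith)]; ring
  rw [habs] at hmean
  set d := 2 * (a - lam.re) with hd
  have hd0 : 0 < d := by simp only [hd]; linarith
  set R := 2 * m + 2 * a with hR
  have hR0 : 0 < R := by positivity
  obtain ⟨L, hLlen, hLspec, hL0⟩ := exists_list_spectrum
    ((2 : ℂ) • M.map Complex.ofReal - (2 * a : ℂ) • (1 : Matrix (Fin N) (Fin N) ℂ))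
  have hLspec' : ∀ μ ∈ L, (μ + 2 * a) / 2 ∈ spectrum ℂ (M.map Complex.ofReal) := by
    intro μ hμ
    have h1 := hLspec μ hμ
    rw [spectrum.mem_iff] at h1 ⊢
    contrapose! h1
    have h2 : algebraMap ℂ (Matrix (Fin N) (Fin N) ℂ) μ -
        ((2 : ℂ) • M.map Complex.ofReal - (2 * a : ℂ) • (1 : Matrix (Fin N) (Fin N) ℂ)) =
        (2 : ℂ) • (algebraMap ℂ (Matrix (Fin N) (Fin N) ℂ) ((μ + 2 * a) / 2) -
          M.map Complex.ofReal) := by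
      simp only [Algebra.algebraMap_eq_smul_one]
      module
    rw [h2]
    exact (isUnit_smul_iff (Units.mk0 (2 : ℂ) two_ne_zero) _).2 h1
  have hBeq : toEuclideanCLM (𝕜 := ℂ)
      ((2 : ℂ) • M.map Complex.ofReal - (2 * a : ℂ) • (1 : Matrix (Fin N) (Fin N) ℂ)) =
      (2 : ℂ) • P - (2 * a : ℂ) • 1 := by
    rw [map_sub, map_smul, map_smul, map_one]
  rw [hBeq] at hL0
  have hbR : 4 * m ≤ R := by simp only [hR]; linarith
  have hdR : d ≤ R := by simp only [hR, hd]; linarith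
  have hq : √N * ((d / (2 * R)) ^ N) * (R * chainGain (4 * m) d L.length) < 1 := by
    rw [hLlen]
    calc √N * ((d / (2 * R)) ^ N) * (R * chainGain (4 * m) d N)
        ≤ √N * ((d / (2 * R)) ^ N) * (N * (R / d) ^ N) := by
          exact mul_le_mul_of_nonneg_left
            (mul_chainGain_le (by positivity) hd0 hbR hdR N) (by positivity)
      _ = √N * N * (d / (2 * R) * (R / d)) ^ N := by rw [mul_pow]; ring
      _ = √N * N / 2 ^ N := by
          have : d / (2 * R) * (R / d) = 1 / 2 := by field_simp
          rw [this, one_div, inv_pow]; rfl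
      _ < 1 := by
          rw [div_lt_one (by positivity)]
          exact sqrt_mul_self_lt_two_pow N
  have hM2 : ∀ x, complexVec ((2 : ℝ) • M *ᵥ x) = (2 : ℂ) • P (complexVec x) := by
    intro x
    rw [hP, toEuclideanCLM_complexVec]
    ext i
    simp [complexVec]
  have key := tendsto_zero_of_chain (M := M) (a := a) (m := m) (κ := κ) (e := e)
    (by positivity : 0 ≤ 4 * m) hd0
    (fun μ hμ => by
      have h1 := hlammax _ (hLspec' μ hμ)
      have h2 : ((μ + 2 * a) / 2).re = (μ.re + 2 * a) / 2 := by simp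
      simp only [hd]
      linarith)
    (fun μ hμ => by
      have h1 := hspec _ (hLspec' μ hμ)
      have h2 : (2 : ℂ) • P - (2 * a : ℂ) • 1 - μ • 1 =
          (2 : ℂ) • (P - ((μ + 2 * a) / 2) • 1) := by module
      rw [h2, norm_smul, Complex.norm_ofNat]
      have h3 : ‖P - ((μ + 2 * a) / 2) • (1 : EuclideanSpace ℂ (Fin N) →L[ℂ] _)‖ ≤ m + m * 1 := by
        refine (norm_sub_le _ _).trans (add_le_add hPm ?_)
        rw [norm_smul]
        exact mul_le_mul h1 ContinuousLinearMap.norm_id_le (norm_nonneg _) hm0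
      linarith)
    hL0 hm0 ha0.le (by positivity)
    (fun x i => by
      refine (abs_le_norm_complexVec _ i).trans ?_
      rw [hM2, norm_smul, Complex.norm_ofNat, mul_assoc]
      gcongr
      exact P.le_of_opNorm_le hPm _)
    (fun x => by
      have h1 := hM2 x
      simp only [_root_.sub_apply, _root_.smul_apply, one_apply_eq_self, ← h1]
      ext i
      simp [complexVec])
    hpos hcont hint htint hmass
    (fun i => (hmean i).trans_eq (by simp only [hd]; congr 1; field_simp)) hq he
  rw [tendsto_pi_nhds]
  intro i
  exact squeeze_zero_norm (fun t => abs_le_norm_complexVec (e t) i) key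

end Delay

theorem integrableOn_sup' {n : ℕ} {s : Set ℝ} (hne : (Finset.univ : Finset (Fin n)).Nonempty)
    {g : Fin n → ℝ → ℝ} (hg : ∀ i, IntegrableOn (g i) s) :
    IntegrableOn (fun t => Finset.univ.sup' hne fun i => g i t) s := by
  have h : IntegrableOn (Finset.univ.sup' hne g) s :=
    Finset.sup'_induction hne g (p := fun f => Integrable f (volume.restrict s))
      (fun f hf f' hf' => hf.sup hf') (fun i _ => hg i)
  have heq : (fun t => Finset.univ.sup' hne fun i => g i t) = Finset.univ.sup' hne g := by
    ext t
    rw [Finset.sup'_apply]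
  rwa [heq]

theorem stmt_19 {n : ℕ} (hn : 1 ≤ n)
    (Ω₁ : Matrix (Fin (2*n)) (Fin (2*n)) ℝ) (hΩ₁sym : Ω₁ᵀ = Ω₁)
    (γ γ' : Fin n → ℝ → ℝ)
    (hγcont : ∀ i, ContinuousOn (γ i) (Set.Ici 0))
    (hγ'cont : ∀ i, ContinuousOn (γ' i) (Set.Ici 0))
    (hγpos : ∀ i, ∀ t ≥ (0:ℝ), 0 < γ i t)
    (hγ'pos : ∀ i, ∀ t ≥ (0:ℝ), 0 < γ' i t)
    (hγint : ∀ i, IntegrableOn (γ i) (Set.Ioi 0))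
    (hγtint : ∀ i, IntegrableOn (fun t => t * γ i t) (Set.Ioi 0))
    (hγ'int : ∀ i, IntegrableOn (γ' i) (Set.Ioi 0))
    (hγ'tint : ∀ i, IntegrableOn (fun t => t * γ' i t) (Set.Ioi 0))
    (γbar γ'bar : Fin n → ℝ)
    (hγbar : ∀ i, γbar i = ∫ t in Set.Ioi (0:ℝ), γ i t)
    (hγ'bar : ∀ i, γ'bar i = ∫ t in Set.Ioi (0:ℝ), γ' i t)
    (Γnp Γ'np : ℝ)
    (hΓnp : Γnp = ∫ t in Set.Ioi (0:ℝ),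
      Finset.univ.sup' ⟨⟨0, hn⟩, Finset.mem_univ _⟩ (fun i => γ i t))
    (hΓ'np : Γ'np = ∫ t in Set.Ioi (0:ℝ),
      Finset.univ.sup' ⟨⟨0, hn⟩, Finset.mem_univ _⟩ (fun i => γ' i t))
    (p p' : ℝ → ℝ)
    (hp : ∀ t, p t =
      (Finset.univ.sup' ⟨⟨0, hn⟩, Finset.mem_univ _⟩ (fun i => γ i t)) / Γnp)
    (hp' : ∀ t, p' t =
      (Finset.univ.sup' ⟨⟨0, hn⟩, Finset.mem_univ _⟩ (fun i => γ' i t)) / Γ'np)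
    (σmin σmax : ℝ)
    (hσmin : σmin = Finset.univ.inf' ⟨⟨0, hn⟩, Finset.mem_univ _⟩ γbar)
    (hσmax : σmax = Finset.univ.sup' ⟨⟨0, hn⟩, Finset.mem_univ _⟩ γbar)
    (lam1 : ℂ)
    (hlam1 : lam1 ∈ spectrum ℂ ((Jmat n * Ω₁).map Complex.ofReal))
    (hlam1max : ∀ μ ∈ spectrum ℂ ((Jmat n * Ω₁).map Complex.ofReal), μ.re ≤ lam1.re)
    (a : ℝ) (ha : opNormR (Jmat n * Ω₁) < a)
    (hcond : (∫ t in Set.Ioi (0:ℝ), t * p t) <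
      |lam1.re - a| ^ (2*n) * σmin /
        (n * (2 * opNormR (Jmat n * Ω₁) + 2 * a * Γnp / σmin) ^ (2*n) *
          (2 * a * Γnp / σmin) * σmax))
    (hsameint : ∀ i, γ'bar i = γbar i)
    (hless : (∫ t in Set.Ioi (0:ℝ), t * p' t) ≤ ∫ t in Set.Ioi (0:ℝ), t * p t)
    (e : ℝ → Fin (2*n) → ℝ)
    (he : ∀ t ≥ (0:ℝ), HasDerivWithinAt e
      (((2:ℝ) • (Jmat n * Ω₁)).mulVec (e t) -
        (2*a) • ∫ τ in Set.Icc (0:ℝ) t,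
          (Matrix.diagonal fun i : Fin (2*n) =>
            γ' ⟨(i:ℕ)/2, by have := i.isLt; omega⟩ (t - τ) /
              γ'bar ⟨(i:ℕ)/2, by have := i.isLt; omega⟩).mulVec (e τ))
      (Set.Ici 0) t) :
    Tendsto e atTop (nhds 0) := by
  set M := Jmat n * Ω₁ with hM
  set m := opNormR M with hm
  have hm0 : 0 ≤ m := norm_nonneg _
  have ha0 : 0 < a := hm0.trans_lt ha
  have hne : (Finset.univ : Finset (Fin n)).Nonempty := ⟨⟨0, hn⟩, Finset.mem_univ _⟩
  have hbarpos : ∀ i, 0 < γbar i := by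
    intro i
    rw [hγbar, setIntegral_pos_iff_support_of_nonneg_ae _ (hγint i)]
    · have hsub : Ioi (0 : ℝ) ⊆ Function.support (γ i) ∩ Ioi 0 := fun t ht =>
        ⟨(hγpos i t (le_of_lt ht)).ne', ht⟩
      exact lt_of_lt_of_le (by simp) (measure_mono hsub)
    · filter_upwards [ae_restrict_mem measurableSet_Ioi] with t ht
      exact (hγpos i t (le_of_lt ht)).le
  have hσmin_le : ∀ i, σmin ≤ γbar i := fun i => hσmin ▸ Finset.inf'_le _ (Finset.mem_univ i)
  have hle_σmax : ∀ i, γbar i ≤ σmax := fun i => hσmax ▸ Finset.le_sup' _ (Finset.mem_univ i)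
  have hσmin0 : 0 < σmin := by
    rw [hσmin]
    exact (Finset.lt_inf'_iff hne).2 fun i _ => hbarpos i
  have hσmax0 : 0 < σmax := (hbarpos ⟨0, hn⟩).trans_le (hle_σmax _)
  have hΓ : σmin ≤ Γnp := by
    refine (hσmin_le ⟨0, hn⟩).trans ?_
    rw [hγbar, hΓnp]
    exact setIntegral_mono_on (hγint _) (integrableOn_sup' hne hγint) measurableSet_Ioi
      fun t _ => Finset.le_sup' (fun i => γ i t) (Finset.mem_univ _)
  have hΓ0 : 0 < Γnp := hσmin0.trans_le hΓ
  have hsup_pos : ∀ t ≥ 0, 0 < Finset.univ.sup' hne fun i => γ' i t := fun t ht =>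
    (hγ'pos ⟨0, hn⟩ t ht).trans_le (Finset.le_sup' (fun i => γ' i t) (Finset.mem_univ _))
  have hΓ'0 : 0 < Γ'np := by
    refine (hbarpos ⟨0, hn⟩).trans_le ?_
    rw [← hsameint, hγ'bar, hΓ'np]
    exact setIntegral_mono_on (hγ'int _) (integrableOn_sup' hne hγ'int) measurableSet_Ioi
      fun t _ => Finset.le_sup' (fun i => γ' i t) (Finset.mem_univ _)
  have hΓ'le : Γ'np ≤ n * σmax := by
    calc Γ'np ≤ ∫ t in Ioi (0 : ℝ), ∑ i, γ' i t := by
          rw [hΓ'np]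
          refine setIntegral_mono_on (integrableOn_sup' hne hγ'int)
            (integrable_finsetSum _ fun i _ => hγ'int i) measurableSet_Ioi fun t ht => ?_
          exact Finset.sup'_le _ _ fun i hi => Finset.single_le_sum
            (f := fun i => γ' i t) (fun j _ => (hγ'pos j t (le_of_lt ht)).le) hi
      _ = ∑ i, γbar i := by
          rw [integral_finsetSum _ fun i _ => hγ'int i]
          exact Finset.sum_congr rfl fun i _ => by rw [← hγ'bar, hsameint]
      _ ≤ ∑ _i : Fin n, σmax := Finset.sum_le_sum fun i _ => hle_σmax i
      _ = n * σmax := by simp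
  set D := ∫ t in Ioi (0 : ℝ), t * p t with hD
  set D' := ∫ t in Ioi (0 : ℝ), t * p' t with hD'
  have hD'eq : ∫ t in Ioi (0 : ℝ), t * Finset.univ.sup' hne (fun i => γ' i t) = Γ'np * D' := by
    rw [hD', ← integral_const_mul]
    refine setIntegral_congr_fun measurableSet_Ioi fun t _ => ?_
    simp only [hp']
    field_simp
  have hD'0 : 0 ≤ D' := setIntegral_nonneg measurableSet_Ioi fun t ht => by
    rw [hp']
    exact mul_nonneg (le_of_lt ht) (div_pos (hsup_pos t (le_of_lt ht)) hΓ'0).le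
  have htsup : IntegrableOn (fun t => t * Finset.univ.sup' hne (fun i => γ' i t)) (Ioi 0) := by
    refine (integrableOn_sup' hne hγ'tint).congr_fun (fun t ht => ?_) measurableSet_Ioi
    exact (Finset.mul₀_sup' (le_of_lt ht) _ _ hne).symm
  have hmoment : ∀ i, ∫ t in Ioi (0 : ℝ), t * γ' i t ≤ n * σmax * D := by
    intro i
    calc ∫ t in Ioi (0 : ℝ), t * γ' i t
        ≤ ∫ t in Ioi (0 : ℝ), t * Finset.univ.sup' hne (fun i => γ' i t) :=
          setIntegral_mono_on (hγ'tint i) htsup measurableSet_Ioi fun t ht =>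
            mul_le_mul_of_nonneg_left
              (Finset.le_sup' (fun i => γ' i t) (Finset.mem_univ i)) (le_of_lt ht)
      _ = Γ'np * D' := hD'eq
      _ ≤ n * σmax * D := mul_le_mul hΓ'le hless hD'0 (by positivity)
  have hn0 : (0 : ℝ) < n := by exact_mod_cast hn
  have hεle : 2 * a / σmin * (n * σmax * D) ≤ (|lam1.re - a| / (2 * m + 2 * a)) ^ (2 * n) := by
    have hQ : 1 ≤ Γnp / σmin := (one_le_div hσmin0).2 hΓ
    calc 2 * a / σmin * (n * σmax * D)
        ≤ 2 * a / σmin * (n * σmax * (|lam1.re - a| ^ (2 * n) * σmin /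
          (n * (2 * m + 2 * a * Γnp / σmin) ^ (2 * n) * (2 * a * Γnp / σmin) * σmax))) := by
          gcongr
      _ = |lam1.re - a| ^ (2 * n) /
          ((2 * m + 2 * a * (Γnp / σmin)) ^ (2 * n) * (Γnp / σmin)) := by
          rw [← mul_div_assoc (2 * a) Γnp σmin]
          have : 0 < (2 * m + 2 * a * Γnp / σmin) ^ (2 * n) := by positivity
          field_simp
      _ ≤ |lam1.re - a| ^ (2 * n) / ((2 * m + 2 * a * 1) ^ (2 * n) * 1) := by
          gcongr
      _ = (|lam1.re - a| / (2 * m + 2 * a)) ^ (2 * n) := by rw [div_pow, mul_one, mul_one]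
  have hecont : ∀ i, ContinuousOn (fun t => e t i) (Ici 0) := fun i t ht =>
    (hasDerivWithinAt_pi.1 (he t ht) i).continuousWithinAt
  let r : Fin (2 * n) → Fin n := fun i => ⟨(i : ℕ) / 2, by have := i.isLt; omega⟩
  refine tendsto_zero_of_delay (κ := fun i t => 2 * a / γbar (r i) * γ' (r i) t) ha hlam1 hlam1max
    (fun i τ hτ => ?_) (fun i => (hγ'cont (r i)).const_mul _) (fun i => (hγ'int (r i)).const_mul _)
    (fun i => ?_) (fun i => ?_) (fun i => ?_) (fun t ht i => ?_)
  · have := hγ'pos (r i) τ hτ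
    have := hbarpos (r i)
    positivity
  · simp only [mul_left_comm _ (2 * a / γbar (r i))]
    exact (hγ'tint (r i)).const_mul _
  · rw [integral_const_mul, ← hγ'bar, hsameint]
    have := (hbarpos (r i)).ne'
    field_simp
  · simp only [mul_left_comm _ (2 * a / γbar (r i))]
    rw [integral_const_mul]
    refine le_trans ?_ hεle
    refine mul_le_mul ?_ (hmoment (r i)) ?_ (by positivity)
    · gcongr
      exact hσmin_le (r i)
    · exact setIntegral_nonneg measurableSet_Ioi fun t ht =>
        mul_nonneg (le_of_lt ht) (hγ'pos (r i) t (le_of_lt ht)).le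
  · refine (hasDerivWithinAt_pi.1 (he t ht) i).congr_deriv ?_
    rw [Pi.sub_apply, Pi.smul_apply, eval_integral, smul_eq_mul, ← integral_const_mul,
      smul_mulVec]
    · congr 1
      refine integral_congr_ae (Eventually.of_forall fun τ => ?_)
      simp only [mulVec_diagonal, hsameint, r]
      ring
    · intro j
      simp only [mulVec_diagonal]
      refine ContinuousOn.integrableOn_Icc (ContinuousOn.mul (ContinuousOn.div_const ?_ _) ?_)
      · exact (hγ'cont (r j)).comp (by fun_prop) fun τ hτ => by simpa using hτ.2
      · exact (hecont j).mono fun τ hτ => hτ.1
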